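/- There exist a compact set K ⊂ ℝ^N and M > 0 such that every Mather measure is supported in K × {q ∈ ℝ^N : |q| ≤ M}; in particular, every Mather measure has compact support. -/

import Mathlib

open MeasureTheory Set
open scoped RealInnerProductSpace

noncomputable section

abbrev Euc (N : ℕ) := EuclideanSpace ℝ (Fin N)

/-- `u` is an (a.e.) subsolution of `H = a` in `ℝ^N`. -/
def IsSubsol {N : ℕ} (H : Euc N × Euc N → ℝ) (a : ℝ) (u : Euc N → ℝ) : Prop :=
  LocallyLipschitz u ∧
    ∀ᵐ x : Euc N ∂volume, DifferentiableAt ℝ u x → H (x, gradient u x) ≤ a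

/-- `u` is an (a.e.) subsolution of the discounted equation `λ u + H(x,Du) = 0`. -/
def IsDiscSubsol {N : ℕ} (H : Euc N × Euc N → ℝ) (lam : ℝ) (u : Euc N → ℝ) : Prop :=
  LocallyLipschitz u ∧
    ∀ᵐ x : Euc N ∂volume, DifferentiableAt ℝ u x →
      lam * u x + H (x, gradient u x) ≤ 0

/-- The Lagrangian associated with `H` via the Fenchel transform. -/
def Lag {N : ℕ} (H : Euc N × Euc N → ℝ) : Euc N × Euc N → ℝ :=
  fun z => sSup (Set.range fun p : Euc N => ⟪p, z.2⟫ - H (z.1, p))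

/-- `u` is a subsolution for the generalized Lagrangian `Φ`. -/
def SubsolFor {N : ℕ} (Φ : Euc N × Euc N → ℝ) (u : Euc N → ℝ) : Prop :=
  LocallyLipschitz u ∧
    ∀ᵐ x : Euc N ∂volume, DifferentiableAt ℝ u x →
      ∀ q : Euc N, fderiv ℝ u x q ≤ Φ (x, q)

/-- `u` is a `λ`-discounted subsolution for the generalized Lagrangian `Φ`. -/
def DiscSubsolFor {N : ℕ} (lam : ℝ) (Φ : Euc N × Euc N → ℝ) (u : Euc N → ℝ) : Prop :=
  LocallyLipschitz u ∧
    ∀ᵐ x : Euc N ∂volume, DifferentiableAt ℝ u x →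
      ∀ q : Euc N, lam * u x + fderiv ℝ u x q ≤ Φ (x, q)

/-- A Mather measure for the ergodic problem. -/
def MatherMeasure {N : ℕ} (H : Euc N × Euc N → ℝ) (μ : Measure (Euc N × Euc N)) : Prop :=
  IsProbabilityMeasure μ ∧ Integrable (Lag H) μ ∧ (∫ z, Lag H z ∂μ) = 0 ∧
    ∀ Φ : Euc N × Euc N → ℝ, Continuous Φ → BddBelow (Set.range Φ) →
      (∃ u, SubsolFor Φ u) → (Integrable Φ μ → 0 ≤ ∫ z, Φ z ∂μ)

/-- A `(λ,z)`-Mather measure (relative to the maximal discounted solution `um`). -/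
def DiscMatherMeasure {N : ℕ} (H : Euc N × Euc N → ℝ) (lam : ℝ) (z : Euc N)
    (um : Euc N → ℝ) (μ : Measure (Euc N × Euc N)) : Prop :=
  IsProbabilityMeasure μ ∧ Integrable (Lag H) μ ∧ (∫ w, Lag H w ∂μ) = lam * um z ∧
    ∀ Φ : Euc N × Euc N → ℝ, Continuous Φ → BddBelow (Set.range Φ) →
      ∀ u : Euc N → ℝ, DiscSubsolFor lam Φ u →
        (Integrable Φ μ → lam * u z ≤ ∫ w, Φ w ∂μ)

/-- A locally Lipschitz function on `ℝ^N` is differentiable almost everywhere. -/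
theorem LocallyLipschitz.ae_differentiableAt_euc {N : ℕ} {u : Euc N → ℝ}
    (hu : LocallyLipschitz u) : ∀ᵐ x : Euc N ∂volume, DifferentiableAt ℝ u x := by
  have hball : ∀ n : ℕ, ∀ᵐ x : Euc N ∂volume, x ∈ Metric.closedBall (0 : Euc N) n →
      DifferentiableWithinAt ℝ u (Metric.closedBall 0 n) x := by
    intro n
    obtain ⟨K, hK⟩ := LocallyLipschitzOn.exists_lipschitzOnWith_of_compact
      (isCompact_closedBall (0 : Euc N) n) hu.locallyLipschitzOn
    exact hK.ae_differentiableWithinAt_of_mem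
  filter_upwards [ae_all_iff.2 hball] with x hx
  obtain ⟨n, hn⟩ := exists_nat_gt ‖x‖
  refine (hx n (by simpa using hn.le)).differentiableAt ?_
  exact Filter.mem_of_superset (Metric.isOpen_ball.mem_nhds (by simpa using hn))
    Metric.ball_subset_closedBall

/-- If a property holds almost everywhere, then on almost every translate of a segment it holds
at almost every time. -/
theorem ae_ae_add_smul {N : ℕ} {P : Euc N → Prop} (hP : ∀ᵐ x : Euc N ∂volume, P x) (y : Euc N) :
    ∀ᵐ x : Euc N ∂volume, ∀ᵐ t : ℝ ∂volume, P (x + t • y) := by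
  obtain ⟨s, hsub, hs, hs0⟩ := exists_measurable_superset_of_null (ae_iff.1 hP)
  have hmeas : MeasurableSet {z : Euc N × ℝ | z.1 + z.2 • y ∉ s} := by
    have hcont : Continuous fun z : Euc N × ℝ => z.1 + z.2 • y := by fun_prop
    exact hcont.measurable hs.compl
  have hae : ∀ᵐ x : Euc N ∂volume, ∀ᵐ t : ℝ ∂volume, x + t • y ∉ s := by
    rw [Measure.ae_ae_comm hmeas]
    refine Filter.Eventually.of_forall fun t => ?_
    exact (measurePreserving_add_right volume (t • y)).quasiMeasurePreserving.ae
      (measure_eq_zero_iff_ae_notMem.1 hs0)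
  filter_upwards [hae] with x hx
  filter_upwards [hx] with t ht
  by_contra hcon
  exact ht (hsub hcon)

/-- An almost everywhere bound on the derivative of a locally Lipschitz function controls its
increments. -/
theorem LocallyLipschitz.abs_sub_le_of_ae_norm_fderiv_le {N : ℕ} {u : Euc N → ℝ}
    (hu : LocallyLipschitz u) {R C : ℝ}
    (hC : ∀ᵐ x : Euc N ∂volume, ‖x‖ ≤ R + 1 → ‖fderiv ℝ u x‖ ≤ C)
    {y : Euc N} (hy : ‖y‖ ≤ R) : |u y - u 0| ≤ C * ‖y‖ := by
  have hae : ∀ᵐ x : Euc N ∂volume, x ∈ Metric.ball (0 : Euc N) 1 →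
      |u (x + y) - u x| ≤ C * ‖y‖ := by
    filter_upwards [ae_ae_add_smul (hu.ae_differentiableAt_euc.and hC) y] with x hx hx1
    have hline : LocallyLipschitz fun t : ℝ => u (x + t • y) := by
      refine hu.comp (LipschitzWith.locallyLipschitz (K := ‖y‖₊) ?_)
      refine LipschitzWith.of_dist_le_mul fun s t => ?_
      rw [dist_add_left, dist_eq_norm, ← sub_smul, norm_smul, dist_eq_norm, mul_comm]
      rfl
    obtain ⟨K, hK⟩ := LocallyLipschitzOn.exists_lipschitzOnWith_of_compact
      (isCompact_uIcc (a := (0 : ℝ)) (b := 1)) hline.locallyLipschitzOn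
    have hftc := hK.absolutelyContinuousOnInterval.integral_deriv_eq_sub
    have hbound := intervalIntegral.norm_integral_le_of_norm_le_const_ae
      (a := 0) (b := 1) (C := C * ‖y‖) (f := deriv fun t : ℝ => u (x + t • y)) (by
        filter_upwards [hx] with t ht htI
        rw [uIoc_of_le zero_le_one] at htI
        have hder : HasDerivAt (fun t : ℝ => x + t • y) y t := by
          simpa using ((hasDerivAt_id t).smul_const y).const_add x
        have hcomp : HasDerivAt (fun t : ℝ => u (x + t • y)) (fderiv ℝ u (x + t • y) y) t :=
          ht.1.hasFDerivAt.comp_hasDerivAt t hder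
        rw [hcomp.deriv]
        refine (ContinuousLinearMap.le_opNorm _ _).trans ?_
        refine mul_le_mul_of_nonneg_right (ht.2 ?_) (norm_nonneg _)
        have hnx : ‖x‖ < 1 := by simpa using hx1
        have hty : ‖t • y‖ ≤ ‖y‖ := by
          rw [norm_smul, Real.norm_of_nonneg htI.1.le]
          exact mul_le_of_le_one_left (norm_nonneg _) htI.2
        linarith [norm_add_le x (t • y)])
    rw [hftc] at hbound
    simpa using hbound
  have hdense : Dense {x : Euc N | x ∈ Metric.ball (0 : Euc N) 1 →
      |u (x + y) - u x| ≤ C * ‖y‖} := Measure.dense_of_ae hae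
  have hcl := hdense.open_subset_closure_inter Metric.isOpen_ball
    (Metric.mem_ball_self (x := (0 : Euc N)) one_pos)
  have hclosed : IsClosed {x : Euc N | |u (x + y) - u x| ≤ C * ‖y‖} := by
    have := hu.continuous
    exact isClosed_le (by fun_prop) continuous_const
  have hmem := closure_minimal (fun x hx => hx.2 hx.1) hclosed hcl
  simpa using hmem

/-- If one of two functions touches the other from above at a point where both are differentiable,
then their derivatives agree there. -/
theorem fderiv_eq_of_le_of_eq {N : ℕ} {f g : Euc N → ℝ} {x : Euc N} (hle : ∀ y, f y ≤ g y)
    (heq : f x = g x) (hf : DifferentiableAt ℝ f x) (hg : DifferentiableAt ℝ g x) :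
    fderiv ℝ f x = fderiv ℝ g x := by
  have hmin : IsLocalMin (fun y => g y - f y) x :=
    Filter.Eventually.of_forall fun y => by simpa [heq] using hle y
  have hzero := hmin.fderiv_eq_zero
  rw [fderiv_fun_sub hg hf] at hzero
  exact (sub_eq_zero.1 hzero).symm

theorem norm_gradient_eq {N : ℕ} (u : Euc N → ℝ) (x : Euc N) :
    ‖gradient u x‖ = ‖fderiv ℝ u x‖ := by
  rw [← toDual_gradient, LinearIsometryEquiv.norm_map]

theorem gradient_eq_of_fderiv_eq {N : ℕ} {u v : Euc N → ℝ} {x : Euc N}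
    (h : fderiv ℝ u x = fderiv ℝ v x) : gradient u x = gradient v x := by
  simp only [gradient, h]

theorem fderiv_apply_eq_inner_gradient {N : ℕ} (u : Euc N → ℝ) (x q : Euc N) :
    fderiv ℝ u x q = ⟪gradient u x, q⟫ := by
  rw [← toDual_gradient, InnerProductSpace.toDual_apply_apply]

/-- If `H(x, p) ≤ m` for large `x` and small `p`, then `H = a` has a subsolution for some `a`. -/
theorem exists_isSubsol {N : ℕ} {H : Euc N × Euc N → ℝ} (hH : Continuous H) {m R : ℝ}
    (hfar : ∀ x : Euc N, R ≤ ‖x‖ → H (x, 0) ≤ m) :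
    {a : ℝ | ∃ u : Euc N → ℝ, IsSubsol H a u}.Nonempty := by
  obtain ⟨C, hC⟩ := (isCompact_closedBall (0 : Euc N) R).bddAbove_image
    (f := fun x => H (x, 0)) (by fun_prop)
  refine ⟨max C m, fun _ => 0, LocallyLipschitz.const 0, Filter.Eventually.of_forall fun x _ => ?_⟩
  rw [gradient_fun_const]
  rcases le_total ‖x‖ R with hx | hx
  · exact (hC ⟨x, by simpa using hx, rfl⟩).trans (le_max_left _ _)
  · exact (hfar x hx).trans (le_max_right _ _)

/-- If `H(x₀, ·) > m`, then the levels of all subsolutions are bounded below by a constant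
larger than `m`. -/
theorem exists_lt_forall_isSubsol_le {N : ℕ} {H : Euc N × Euc N → ℝ} (hH : Continuous H)
    (hcoer : ∀ R : ℝ, 0 < R → ∀ C : ℝ, ∃ r : ℝ, ∀ x p : Euc N,
      ‖x‖ ≤ R → r ≤ ‖p‖ → C ≤ H (x, p))
    {m : ℝ} {x₀ : Euc N} (hx₀ : ∀ p : Euc N, m < H (x₀, p)) :
    ∃ b > m, ∀ a : ℝ, (∃ u : Euc N → ℝ, IsSubsol H a u) → b ≤ a := by
  obtain ⟨r, hr⟩ := hcoer (‖x₀‖ + 1) (by positivity) (m + 1)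
  obtain ⟨p₀, -, hp₀⟩ := (isCompact_closedBall (0 : Euc N) |r|).exists_isMinOn
    ⟨0, by simp⟩ (f := fun p => H (x₀, p)) (by fun_prop)
  obtain ⟨b, hmb, hb⟩ := exists_between (hx₀ p₀)
  obtain ⟨U, V, hU, -, hxU, hV, hUV⟩ := generalized_tube_lemma (isCompact_singleton (x := x₀))
    (isCompact_closedBall (0 : Euc N) |r|) (isOpen_Ioi.preimage hH : IsOpen (H ⁻¹' Ioi b)) (by
      rintro ⟨x, p⟩ ⟨rfl, hp⟩
      exact hb.trans_le (hp₀ hp))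
  refine ⟨min b (m + 1), lt_min hmb (by linarith), ?_⟩
  rintro a ⟨u, hu, hsub⟩
  have hdense := Measure.dense_of_ae (hu.ae_differentiableAt_euc.and hsub)
  obtain ⟨x, ⟨hxU', hxB⟩, hxd, hxs⟩ := hdense.inter_open_nonempty (U ∩ Metric.ball x₀ 1)
    (hU.inter Metric.isOpen_ball) ⟨x₀, hxU rfl, Metric.mem_ball_self one_pos⟩
  refine le_trans ?_ (hxs hxd)
  rcases le_total ‖gradient u x‖ |r| with hp | hp
  · exact (min_le_left _ _).trans (hUV ⟨hxU', hV (by simpa using hp)⟩ : b < _).le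
  · refine (min_le_right _ _).trans (hr x _ ?_ ((le_abs_self r).trans hp))
    have hdist : ‖x - x₀‖ < 1 := by simpa [dist_eq_norm] using hxB
    linarith [norm_le_norm_add_norm_sub' x x₀]

/-- Subsolutions of level at most one have uniformly bounded oscillation on balls. -/
theorem exists_forall_isSubsol_abs_sub_le {N : ℕ} {H : Euc N × Euc N → ℝ}
    (hcoer : ∀ R : ℝ, 0 < R → ∀ C : ℝ, ∃ r : ℝ, ∀ x p : Euc N,
      ‖x‖ ≤ R → r ≤ ‖p‖ → C ≤ H (x, p)) {R : ℝ} (hR : 0 < R) :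
    ∃ A : ℝ, 0 ≤ A ∧ ∀ a ≤ (1 : ℝ), ∀ u : Euc N → ℝ, IsSubsol H a u →
      ∀ x : Euc N, ‖x‖ ≤ R → |u x - u 0| ≤ A := by
  obtain ⟨r, hr⟩ := hcoer (R + 1) (by positivity) 2
  refine ⟨|r| * R, by positivity, fun a ha u hu x hx => ?_⟩
  refine (hu.1.abs_sub_le_of_ae_norm_fderiv_le (C := |r|) ?_ hx).trans
    (mul_le_mul_of_nonneg_left hx (abs_nonneg _))
  filter_upwards [hu.1.ae_differentiableAt_euc, hu.2] with y hyd hys hyR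
  rw [← norm_gradient_eq]
  by_contra! hcon
  linarith [hr y _ hyR ((le_abs_self r).trans hcon.le), hys hyd]

/-- A subsolution can be modified outside a ball so that it becomes a strict subsolution with
small gradient outside a larger ball whose size depends only on the oscillation of the original
subsolution. -/
theorem IsSubsol.exists_strict_at_infinity {N : ℕ} {H : Euc N × Euc N → ℝ} {u : Euc N → ℝ}
    {a m ε R A : ℝ} (hu : IsSubsol H a u) (ha : 0 ≤ a) (hm : m ≤ 0) (hε : 0 < ε)
    (hfar : ∀ x : Euc N, R ≤ ‖x‖ → ∀ p : Euc N, ‖p‖ ≤ ε → H (x, p) ≤ m)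
    (hA : ∀ x : Euc N, ‖x‖ ≤ R → |u x - u 0| ≤ A) :
    ∃ g : Euc N → ℝ, LocallyLipschitz g ∧ ∀ᵐ x : Euc N ∂volume, DifferentiableAt ℝ g x →
      H (x, gradient g x) ≤ a ∧
      (R + 2 * A / ε < ‖x‖ → ‖gradient g x‖ ≤ ε ∧ H (x, gradient g x) ≤ m) := by
  set v : Euc N → ℝ := fun x => max (u x) (u 0 - A) with hv
  set φ : Euc N → ℝ := fun x => u 0 + A + ε * (R - ‖x‖) with hφ
  have hφlip : LipschitzWith ⟨ε, hε.le⟩ φ := by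
    refine LipschitzWith.of_dist_le_mul fun x y => ?_
    have hsub : φ x - φ y = ε * (‖y‖ - ‖x‖) := by simp only [hφ]; ring
    rw [Real.dist_eq, hsub, abs_mul, abs_of_pos hε, abs_sub_comm, dist_eq_norm]
    exact mul_le_mul_of_nonneg_left (abs_norm_sub_norm_le x y) hε.le
  have hvlip : LocallyLipschitz v := hu.1.max_const _
  have hglip : LocallyLipschitz fun x => min (v x) (φ x) := hvlip.min hφlip.locallyLipschitz
  refine ⟨fun x => min (v x) (φ x), hglip, ?_⟩
  filter_upwards [hu.1.ae_differentiableAt_euc, hvlip.ae_differentiableAt_euc,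
    hφlip.ae_differentiableAt, hu.2] with x hxu hxv hxφ hxs hxg
  have small_of_eq_φ : φ x ≤ v x → ‖gradient (fun x => min (v x) (φ x)) x‖ ≤ ε := by
    intro hle
    rw [norm_gradient_eq, fderiv_eq_of_le_of_eq (fun y => min_le_right (v y) (φ y))
      (min_eq_right hle) hxg hxφ]
    exact norm_fderiv_le_of_lipschitz ℝ hφlip
  have touch_v : v x ≤ φ x →
      fderiv ℝ (fun x => min (v x) (φ x)) x = fderiv ℝ v x := fun hle =>
    fderiv_eq_of_le_of_eq (fun y => min_le_left (v y) (φ y)) (min_eq_left hle) hxg hxv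
  have touch_u : u 0 - A ≤ u x → fderiv ℝ v x = fderiv ℝ u x := fun hle =>
    (fderiv_eq_of_le_of_eq (fun y => le_max_left (u y) (u 0 - A)) (max_eq_left hle).symm
      hxu hxv).symm
  have touch_const : u x ≤ u 0 - A → fderiv ℝ v x = 0 := fun hle => by
    rw [← fderiv_eq_of_le_of_eq (fun y => le_max_right (u y) (u 0 - A)) (max_eq_right hle).symm
      (differentiableAt_const _) hxv, fderiv_const_apply]
  refine ⟨?_, fun hx => ?_⟩
  · rcases le_total ‖x‖ R with hxR | hxR
    · have hAx := abs_le.1 (hA x hxR)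
      have hvle : v x ≤ φ x := by
        have := mul_nonneg hε.le (sub_nonneg.2 hxR)
        exact max_le (by simp only [hφ]; linarith) (by simp only [hφ]; linarith)
      rw [gradient_eq_of_fderiv_eq ((touch_v hvle).trans (touch_u (by linarith)))]
      exact hxs hxu
    · rcases le_total (v x) (φ x) with hle | hle
      · rcases le_total (u 0 - A) (u x) with hle' | hle'
        · rw [gradient_eq_of_fderiv_eq ((touch_v hle).trans (touch_u hle'))]
          exact hxs hxu
        · refine (hfar x hxR _ ?_).trans (hm.trans ha)
          rw [norm_gradient_eq, touch_v hle, touch_const hle', norm_zero]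
          exact hε.le
      · exact (hfar x hxR _ (small_of_eq_φ hle)).trans (hm.trans ha)
  · have hφv : φ x ≤ v x := by
      refine le_trans ?_ (le_max_right _ _)
      have hlt : 2 * A / ε < ‖x‖ - R := by linarith
      rw [div_lt_iff₀ hε] at hlt
      simp only [hφ]
      linarith
    have hRx : R ≤ ‖x‖ := by
      by_contra! hcon
      have hA0 : 0 ≤ A := (abs_nonneg _).trans (hA x hcon.le)
      have : 0 ≤ 2 * A / ε := by positivity
      linarith
    exact ⟨small_of_eq_φ hφv, hfar x hRx _ (small_of_eq_φ hφv)⟩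

/-- The Lagrangian obtained by restricting the Fenchel transform to momenta of norm at most `r`. -/
def truncLag {N : ℕ} (H : Euc N × Euc N → ℝ) (r : ℝ) : Euc N × Euc N → ℝ :=
  fun z => sSup ((fun p : Euc N => ⟪p, z.2⟫ - H (z.1, p)) '' Metric.closedBall 0 r)

theorem continuous_truncLag {N : ℕ} {H : Euc N × Euc N → ℝ} (hH : Continuous H) (r : ℝ) :
    Continuous (truncLag H r) := by
  refine (isCompact_closedBall (0 : Euc N) r).continuous_sSup
    (f := fun (z : Euc N × Euc N) (p : Euc N) => ⟪p, z.2⟫ - H (z.1, p)) ?_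
  change Continuous fun w : (Euc N × Euc N) × Euc N => ⟪w.2, w.1.2⟫ - H (w.1.1, w.2)
  fun_prop

theorem inner_sub_le_truncLag {N : ℕ} {H : Euc N × Euc N → ℝ} (hH : Continuous H) {r : ℝ}
    {p : Euc N} (hp : ‖p‖ ≤ r) (x q : Euc N) : ⟪p, q⟫ - H (x, p) ≤ truncLag H r (x, q) :=
  le_csSup ((isCompact_closedBall (0 : Euc N) r).bddAbove_image (by fun_prop))
    ⟨p, by simpa using hp, rfl⟩

theorem truncLag_le {N : ℕ} {H : Euc N × Euc N → ℝ} {r C : ℝ} (hr : 0 ≤ r) {x : Euc N}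
    (hC : ∀ p : Euc N, ‖p‖ ≤ r → -C ≤ H (x, p)) (q : Euc N) :
    truncLag H r (x, q) ≤ r * ‖q‖ + C := by
  refine csSup_le ⟨_, 0, by simpa using hr, rfl⟩ ?_
  rintro _ ⟨p, hp, rfl⟩
  have hp' : ‖p‖ ≤ r := by simpa using hp
  have hinner := (real_inner_le_norm p q).trans (mul_le_mul_of_nonneg_right hp' (norm_nonneg q))
  have := hC p hp'
  dsimp only
  linarith

/-- For a superlinear Hamiltonian the supremum defining the Lagrangian is finite. -/
theorem inner_sub_le_lag {N : ℕ} {H : Euc N × Euc N → ℝ} (hH : Continuous H)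
    (hsl : ∀ x : Euc N, ∀ C : ℝ, ∃ r : ℝ, ∀ p : Euc N, r ≤ ‖p‖ → C * ‖p‖ ≤ H (x, p))
    (x q p : Euc N) : ⟪p, q⟫ - H (x, p) ≤ Lag H (x, q) := by
  obtain ⟨r, hr⟩ := hsl x ‖q‖
  refine le_csSup ⟨max 0 (truncLag H r (x, q)), ?_⟩ ⟨p, rfl⟩
  rintro _ ⟨p', rfl⟩
  rcases le_total r ‖p'‖ with hp | hp
  · refine le_max_of_le_left ?_
    have h1 := hr p' hp
    have h2 := real_inner_le_norm p' q
    dsimp only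
    linarith
  · exact le_max_of_le_right (inner_sub_le_truncLag hH hp x q)

theorem truncLag_le_lag {N : ℕ} {H : Euc N × Euc N → ℝ} (hH : Continuous H)
    (hsl : ∀ x : Euc N, ∀ C : ℝ, ∃ r : ℝ, ∀ p : Euc N, r ≤ ‖p‖ → C * ‖p‖ ≤ H (x, p))
    {r : ℝ} (hr : 0 ≤ r) (z : Euc N × Euc N) : truncLag H r z ≤ Lag H z := by
  refine csSup_le ⟨_, 0, by simpa using hr, rfl⟩ ?_
  rintro _ ⟨p, -, rfl⟩
  exact inner_sub_le_lag hH hsl z.1 z.2 p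

/-- A lower bound of the Lagrangian with arbitrary linear growth. -/
theorem mul_norm_sub_le_lag {N : ℕ} {H : Euc N × Euc N → ℝ} (hH : Continuous H)
    (hsl : ∀ x : Euc N, ∀ C : ℝ, ∃ r : ℝ, ∀ p : Euc N, r ≤ ‖p‖ → C * ‖p‖ ≤ H (x, p))
    {s C : ℝ} (hs : 0 ≤ s) {x : Euc N} (hC : ∀ p : Euc N, ‖p‖ ≤ s → H (x, p) ≤ C) (q : Euc N) :
    s * ‖q‖ - C ≤ Lag H (x, q) := by
  have hnorm : ‖(s / ‖q‖) • q‖ ≤ s := by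
    rw [norm_smul, Real.norm_of_nonneg (by positivity)]
    rcases eq_or_ne ‖q‖ 0 with h | h
    · simpa [h] using hs
    · rw [div_mul_cancel₀ _ h]
  have hinner : ⟪(s / ‖q‖) • q, q⟫ = s * ‖q‖ := by
    rw [real_inner_smul_left, real_inner_self_eq_norm_sq]
    rcases eq_or_ne ‖q‖ 0 with h | h
    · simp [h]
    · field_simp
  have h1 := inner_sub_le_lag hH hsl x q ((s / ‖q‖) • q)
  have h2 := hC _ hnorm
  linarith

/-- If `Ψ` lies below the Lagrangian and `Ψ + a` admits a subsolution for arbitrarily small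
`a > 0`, then `Ψ` agrees with the Lagrangian almost everywhere for any Mather measure. -/
theorem MatherMeasure.ae_eq_of_forall_subsolFor {N : ℕ} {H Ψ : Euc N × Euc N → ℝ}
    {μ : Measure (Euc N × Euc N)} (hμ : MatherMeasure H μ) (hΨ : Continuous Ψ)
    (hbdd : BddBelow (range Ψ)) (hle : ∀ z, Ψ z ≤ Lag H z)
    (hsub : ∀ a > (0 : ℝ), a ≤ 1 → ∃ g, SubsolFor (fun z => Ψ z + a) g) :
    ∀ᵐ z ∂μ, Ψ z = Lag H z := by
  obtain ⟨hprob, hint, hzero, htest⟩ := hμ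
  obtain ⟨B, hB⟩ := hbdd
  have hΨint : Integrable Ψ μ :=
    integrable_of_le_of_le hΨ.aestronglyMeasurable
      (Filter.Eventually.of_forall fun z => hB ⟨z, rfl⟩) (Filter.Eventually.of_forall hle)
      (integrable_const B) hint
  have happrox : ∀ a > (0 : ℝ), a ≤ 1 → -a ≤ ∫ z, Ψ z ∂μ := by
    intro a ha ha1
    have h0 := htest (fun z => Ψ z + a) (by fun_prop)
      ⟨B + a, by rintro _ ⟨z, rfl⟩; exact add_le_add_left (hB ⟨z, rfl⟩) a⟩ (hsub a ha ha1)
      (hΨint.add (integrable_const a))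
    rw [integral_add hΨint (integrable_const a)] at h0
    simp only [integral_const, probReal_univ, one_smul] at h0
    linarith
  have hnonneg : 0 ≤ ∫ z, Ψ z ∂μ := by
    by_contra! hneg
    have hpos : 0 < min 1 (-(∫ z, Ψ z ∂μ) / 2) := lt_min one_pos (by linarith)
    have := happrox _ hpos (min_le_left _ _)
    have := min_le_right 1 (-(∫ z, Ψ z ∂μ) / 2)
    linarith
  have hgap : ∫ z, (Lag H z - Ψ z) ∂μ = 0 := by
    refine le_antisymm ?_ (integral_nonneg fun z => sub_nonneg.2 (hle z))
    rw [integral_sub hint hΨint]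
    linarith
  have hae := (integral_eq_zero_iff_of_nonneg (fun z => sub_nonneg.2 (hle z))
    (hint.sub hΨint)).1 hgap
  filter_upwards [hae] with z hz
  exact (sub_eq_zero.1 hz).symm

theorem stmt12 {N : ℕ} (hN : 1 ≤ N) (H : Euc N × Euc N → ℝ)
    (hA1 : Continuous H)
    (hA2conv : ∀ x : Euc N, ConvexOn ℝ Set.univ fun p => H (x, p))
    (hA2coer : ∀ R : ℝ, 0 < R → ∀ C : ℝ, ∃ r : ℝ, ∀ x p : Euc N,
      ‖x‖ ≤ R → r ≤ ‖p‖ → C ≤ H (x, p))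
    (hA3 : ∃ ε > (0 : ℝ), ∃ m : ℝ,
      (∃ R : ℝ, ∀ x : Euc N, R ≤ ‖x‖ → ∀ p : Euc N, ‖p‖ ≤ ε → H (x, p) ≤ m) ∧
      (∃ x₀ : Euc N, ∀ p : Euc N, m < H (x₀, p)))
    (hcrit : sInf {a : ℝ | ∃ u : Euc N → ℝ, IsSubsol H a u} = 0)
    (hsl : ∀ x : Euc N, ∀ C : ℝ, ∃ r : ℝ, ∀ p : Euc N, r ≤ ‖p‖ → C * ‖p‖ ≤ H (x, p))
 :
    ∃ K : Set (Euc N), IsCompact K ∧ ∃ M : ℝ, 0 < M ∧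
      ∀ μ : Measure (Euc N × Euc N), MatherMeasure H μ →
        μ ((K ×ˢ Metric.closedBall (0 : Euc N) M)ᶜ) = 0 := by
  obtain ⟨ε, hε, m, ⟨R₀, hR₀⟩, x₀, hx₀⟩ := hA3
  obtain ⟨R, hR, hfar⟩ : ∃ R : ℝ, 0 < R ∧
      ∀ x : Euc N, R ≤ ‖x‖ → ∀ p : Euc N, ‖p‖ ≤ ε → H (x, p) ≤ m :=
    ⟨max R₀ 1, by positivity, fun x hx => hR₀ x ((le_max_left _ _).trans hx)⟩
  have hne := exists_isSubsol hA1 fun x hx => hfar x hx 0 (by simpa using hε.le)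
  have hm : m < 0 := by
    obtain ⟨b, hmb, hb⟩ := exists_lt_forall_isSubsol_le hA1 hA2coer hx₀
    have := le_csInf hne hb
    linarith
  obtain ⟨A, hA, hosc⟩ := exists_forall_isSubsol_abs_sub_le hA2coer hR
  obtain ⟨R', hR'eq⟩ : ∃ R' : ℝ, R' = R + 2 * A / ε := ⟨_, rfl⟩
  have hR' : 0 < R' := hR'eq ▸ by positivity
  obtain ⟨r₂, hr₂⟩ := hA2coer R' hR' 2
  obtain ⟨r, hrr₂, hrε⟩ : ∃ r : ℝ, r₂ ≤ r ∧ ε ≤ r := ⟨_, le_max_left _ _, le_max_right _ _⟩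
  have hr : 0 ≤ r := hε.le.trans hrε
  obtain ⟨χ, hχcont, hχ0, hχ1, hχin, hχout⟩ : ∃ χ : Euc N → ℝ, Continuous χ ∧
      (∀ x, 0 ≤ χ x) ∧ (∀ x, χ x ≤ 1) ∧ (∀ x, ‖x‖ ≤ R' → χ x = 0) ∧ ∀ x, R' < ‖x‖ → 0 < χ x :=
    ⟨fun x => max 0 (min 1 (‖x‖ - R')), by fun_prop, fun x => le_max_left _ _,
      fun x => max_le zero_le_one (min_le_left _ _),
      fun x hx => max_eq_left ((min_le_right _ _).trans (by linarith)),
      fun x hx => lt_max_of_lt_right (lt_min one_pos (by linarith))⟩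
  have hsubsol : ∀ a > (0 : ℝ), a ≤ 1 →
      ∃ g, SubsolFor (fun z => truncLag H r z + m * χ z.1 + a) g := by
    intro a ha ha1
    obtain ⟨a', ⟨u, hu⟩, ha'⟩ := exists_lt_of_csInf_lt hne (hcrit.trans_lt ha)
    have hua : IsSubsol H a u := ⟨hu.1, hu.2.mono fun x hx hd => (hx hd).trans ha'.le⟩
    obtain ⟨g, hglip, hg⟩ := hua.exists_strict_at_infinity ha.le hm.le hε hfar
      (hosc a ha1 u hua)
    rw [← hR'eq] at hg
    refine ⟨g, hglip, ?_⟩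
    filter_upwards [hg] with x hx hxd q
    obtain ⟨hxa, hxfar⟩ := hx hxd
    have hgr : ‖gradient g x‖ ≤ r ∧ H (x, gradient g x) ≤ m * χ x + a := by
      rcases le_or_gt ‖x‖ R' with hxR | hxR
      · refine ⟨le_trans ?_ hrr₂, by rw [hχin x hxR]; linarith⟩
        by_contra! hcon
        linarith [hr₂ x _ hxR hcon.le]
      · obtain ⟨h1, h2⟩ := hxfar hxR
        exact ⟨h1.trans hrε, by nlinarith [hχ1 x]⟩
    rw [fderiv_apply_eq_inner_gradient]
    have := inner_sub_le_truncLag hA1 hgr.1 x q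
    linarith [hgr.2]
  have hbdd : BddBelow (range fun z : Euc N × Euc N => truncLag H r z + m * χ z.1) := by
    obtain ⟨C, hC⟩ := (isCompact_closedBall (0 : Euc N) R).bddAbove_image
      (f := fun x => H (x, 0)) (by fun_prop)
    refine ⟨-max C m + m, ?_⟩
    rintro _ ⟨⟨x, q⟩, rfl⟩
    have h1 := inner_sub_le_truncLag hA1 (p := 0) (by simpa using hr) x q
    rw [inner_zero_left] at h1
    have h2 : H (x, 0) ≤ max C m := by
      rcases le_total ‖x‖ R with hx | hx
      · exact (hC ⟨x, by simpa using hx, rfl⟩).trans (le_max_left _ _)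
      · exact (hfar x hx 0 (by simpa using hε.le)).trans (le_max_right _ _)
    have h3 : m ≤ m * χ x := by nlinarith [hχ1 x]
    dsimp only
    linarith
  obtain ⟨C, hC⟩ := ((isCompact_closedBall (0 : Euc N) R').prod
    (isCompact_closedBall (0 : Euc N) (r + 1))).exists_bound_of_continuousOn hA1.continuousOn
  refine ⟨Metric.closedBall 0 R', isCompact_closedBall _ _, max 1 (2 * C), by positivity, ?_⟩
  intro μ hμ
  have hle : ∀ z : Euc N × Euc N, truncLag H r z + m * χ z.1 ≤ Lag H z := fun z => by
    have h1 := truncLag_le_lag hA1 hsl hr z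
    nlinarith [hχ0 z.1]
  have hae := hμ.ae_eq_of_forall_subsolFor
    ((continuous_truncLag hA1 r).add (g := fun z => m * χ z.1) (by fun_prop)) hbdd hle hsubsol
  refine measure_mono_null ?_ (ae_iff.1 hae)
  rintro ⟨x, q⟩ hz heq
  refine hz ?_
  replace heq : truncLag H r (x, q) + m * χ x = Lag H (x, q) := heq
  have hlag := truncLag_le_lag hA1 hsl hr (x, q)
  have hxR : ‖x‖ ≤ R' := by
    by_contra! hcon
    linarith [mul_neg_of_neg_of_pos hm (hχout x hcon)]
  have hH : ∀ p : Euc N, ‖p‖ ≤ r + 1 → |H (x, p)| ≤ C := fun p hp =>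
    hC (x, p) ⟨by simpa using hxR, by simpa using hp⟩
  have h1 := truncLag_le hr (fun p hp => (abs_le.1 (hH p (by linarith))).1) q
  have h2 := mul_norm_sub_le_lag hA1 hsl (s := r + 1) (by linarith)
    (fun p hp => (abs_le.1 (hH p hp)).2) q
  have h3 : m * χ x ≤ 0 := mul_nonpos_of_nonpos_of_nonneg hm.le (hχ0 x)
  refine ⟨by simpa using hxR, ?_⟩
  rw [mem_closedBall_zero_iff]
  refine le_max_of_le_right ?_
  dsimp only
  linarith

end
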